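/- Let U ⊆ ℂ be open and connected, z₀ ∈ U, and let c : U → ℂ^n be a holomorphic map with c(z) ∈ σ(ℂ^m) for all z ∈ U. Then there exist a positive integer N, a δ > 0, and a holomorphic map c̄ : {z ∈ ℂ : |z−z₀| < δ} → ℂ^m such that z₀ + (z−z₀)^N ∈ U and σ(c̄(z)) = c(z₀ + (z−z₀)^N) for all z with |z−z₀| < δ. (This is the paper's generalization of Puiseux's theorem in the case of a finite group.) -/

import Mathlib

open MeasureTheory Set Filter

section Puiseux

open Polynomial
open scoped Topology

/-- The polynomial of degree `< d` with coefficient vector `u`. -/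
noncomputable def lowPoly {d : ℕ} (u : Fin d → ℂ) : ℂ[X] := ∑ i, C (u i) * X ^ (i : ℕ)

/-- The monic polynomial of degree `d` with lower coefficient vector `u`. -/
noncomputable def monicPoly {d : ℕ} (u : Fin d → ℂ) : ℂ[X] := X ^ d + lowPoly u

lemma degree_lowPoly_lt {d : ℕ} (u : Fin d → ℂ) : (lowPoly u).degree < d :=
  degree_sum_fin_lt u

lemma coeff_lowPoly {d : ℕ} (u : Fin d → ℂ) (i : Fin d) : (lowPoly u).coeff i = u i := by
  simp [lowPoly, finsetSum_coeff, coeff_X_pow, Fin.val_inj]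

lemma lowPoly_injective {d : ℕ} : Function.Injective (lowPoly (d := d)) := fun u v h => by
  funext i
  rw [← coeff_lowPoly u, h, coeff_lowPoly]

lemma lowPoly_zero {d : ℕ} : lowPoly (0 : Fin d → ℂ) = 0 := by simp [lowPoly]

lemma lowPoly_add_smul {d : ℕ} (u v : Fin d → ℂ) (s : ℂ) :
    lowPoly (u + s • v) = lowPoly u + C s * lowPoly v := by
  simp only [lowPoly, Pi.add_apply, Pi.smul_apply, smul_eq_mul, C_add, C_mul, add_mul,
    Finset.sum_add_distrib, Finset.mul_sum, mul_assoc]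

lemma monicPoly_monic {d : ℕ} (u : Fin d → ℂ) : (monicPoly u).Monic :=
  monic_X_pow_add (degree_lowPoly_lt u)

lemma natDegree_monicPoly {d : ℕ} (u : Fin d → ℂ) : (monicPoly u).natDegree = d := by
  have h : (monicPoly u).degree = d := by
    rw [monicPoly, degree_add_eq_left_of_degree_lt] <;> simp [degree_lowPoly_lt]
  exact natDegree_eq_of_degree_eq_some h

lemma degree_monicPoly {d : ℕ} (u : Fin d → ℂ) : (monicPoly u).degree = d := by
  rw [degree_eq_natDegree (monicPoly_monic u).ne_zero, natDegree_monicPoly]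

lemma coeff_monicPoly {d : ℕ} (u : Fin d → ℂ) (i : Fin d) : (monicPoly u).coeff i = u i := by
  simp [monicPoly, coeff_lowPoly, coeff_X_pow, i.2.ne]

lemma monicPoly_coeff {d : ℕ} {P : ℂ[X]} (hP : P.Monic) (hd : P.natDegree = d) :
    monicPoly (fun i : Fin d => P.coeff i) = P := by
  subst hd
  conv_rhs => rw [hP.as_sum]
  rw [monicPoly, lowPoly, Finset.sum_range]

lemma eval_monicPoly {d : ℕ} (u : Fin d → ℂ) (t : ℂ) :
    (monicPoly u).eval t = t ^ d + ∑ i, u i * t ^ (i : ℕ) := by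
  simp [monicPoly, lowPoly, eval_finsetSum]

section AnalyticCoeff

variable {E : Type*} [NormedAddCommGroup E] [NormedSpace ℂ E]

/-- A family of polynomials all of whose coefficients are analytic at `x`. -/
def AnalyticCoeffAt (P : E → ℂ[X]) (x : E) : Prop :=
  ∀ i, AnalyticAt ℂ (fun y => (P y).coeff i) x

variable {P Q : E → ℂ[X]} {x : E}

lemma analyticCoeffAt_const (p : ℂ[X]) : AnalyticCoeffAt (fun _ : E => p) x :=
  fun _ => analyticAt_const

lemma AnalyticAt.analyticCoeffAt_C {f : E → ℂ} (hf : AnalyticAt ℂ f x) :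
    AnalyticCoeffAt (fun y => C (f y)) x := fun i => by
  by_cases hi : i = 0
  · simpa [hi] using hf
  · simpa [coeff_C, hi] using analyticAt_const

lemma AnalyticCoeffAt.add (hP : AnalyticCoeffAt P x) (hQ : AnalyticCoeffAt Q x) :
    AnalyticCoeffAt (fun y => P y + Q y) x := fun i => by
  simpa only [coeff_add] using (hP i).fun_add (hQ i)

lemma AnalyticCoeffAt.mul (hP : AnalyticCoeffAt P x) (hQ : AnalyticCoeffAt Q x) :
    AnalyticCoeffAt (fun y => P y * Q y) x := fun i => by
  simpa only [coeff_mul] using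
    Finset.analyticAt_fun_sum _ fun j _ => (hP j.1).fun_mul (hQ j.2)

lemma AnalyticCoeffAt.pow (hP : AnalyticCoeffAt P x) (k : ℕ) :
    AnalyticCoeffAt (fun y => P y ^ k) x := by
  induction k with
  | zero => simpa using analyticCoeffAt_const 1
  | succ k ih => simpa only [pow_succ] using ih.mul hP

lemma AnalyticCoeffAt.sum {ι : Type*} (s : Finset ι) {P : ι → E → ℂ[X]}
    (hP : ∀ j ∈ s, AnalyticCoeffAt (P j) x) : AnalyticCoeffAt (fun y => ∑ j ∈ s, P j y) x :=
  fun i => by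
    simpa only [finsetSum_coeff] using Finset.analyticAt_fun_sum _ fun j hj => hP j hj i

lemma AnalyticAt.analyticCoeffAt_monicPoly {d : ℕ} {u : E → Fin d → ℂ}
    (hu : AnalyticAt ℂ u x) : AnalyticCoeffAt (fun y => monicPoly (u y)) x :=
  (analyticCoeffAt_const _).add <| AnalyticCoeffAt.sum _ fun i _ =>
    (analyticAt_pi_iff.1 hu i).analyticCoeffAt_C.mul (analyticCoeffAt_const _)

lemma AnalyticCoeffAt.analyticAt_coeff (hP : AnalyticCoeffAt P x) (d : ℕ) :
    AnalyticAt ℂ (fun y (i : Fin d) => (P y).coeff i) x :=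
  analyticAt_pi_iff.2 fun i => hP i

end AnalyticCoeff

lemma eq_zero_of_isCoprime_of_add_mul_eq_zero {Q R V W : ℂ[X]} (hQR : IsCoprime Q R)
    (hV : V.degree < Q.degree) (h : V * R + Q * W = 0) : V = 0 := by
  have : Q ∣ V := hQR.dvd_of_dvd_mul_right ⟨-W, by linear_combination h⟩
  exact eq_zero_of_dvd_of_degree_lt this hV

/-- The lower coefficients of the product of two monic polynomials. -/
noncomputable def mulCoeff {a b : ℕ} (p : (Fin a → ℂ) × (Fin b → ℂ)) : Fin (a + b) → ℂ :=
  fun i => (monicPoly p.1 * monicPoly p.2).coeff i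

lemma monicPoly_mulCoeff {a b : ℕ} (p : (Fin a → ℂ) × (Fin b → ℂ)) :
    monicPoly (mulCoeff p) = monicPoly p.1 * monicPoly p.2 :=
  monicPoly_coeff ((monicPoly_monic _).mul (monicPoly_monic _)) <| by
    rw [(monicPoly_monic _).natDegree_mul (monicPoly_monic _), natDegree_monicPoly,
      natDegree_monicPoly]

lemma analyticAt_mulCoeff {a b : ℕ} (p : (Fin a → ℂ) × (Fin b → ℂ)) :
    AnalyticAt ℂ mulCoeff p :=
  (analyticAt_fst.analyticCoeffAt_monicPoly.mul
    analyticAt_snd.analyticCoeffAt_monicPoly).analyticAt_coeff _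

lemma fderiv_mulCoeff {a b : ℕ} (p v : (Fin a → ℂ) × (Fin b → ℂ)) (i : Fin (a + b)) :
    fderiv ℂ mulCoeff p v i =
      (lowPoly v.1 * monicPoly p.2 + monicPoly p.1 * lowPoly v.2).coeff i := by
  have h1 : HasDerivAt (fun s : ℂ => mulCoeff (p + s • v)) (fderiv ℂ mulCoeff p v) 0 :=
    (analyticAt_mulCoeff p).differentiableAt.hasFDerivAt.hasLineDerivAt v
  have h2 := (hasDerivAt_pi.1 h1) i
  have h3 : (fun s : ℂ => mulCoeff (p + s • v) i) = fun s : ℂ =>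
      (monicPoly p.1 * monicPoly p.2).coeff i +
      s * (lowPoly v.1 * monicPoly p.2 + monicPoly p.1 * lowPoly v.2).coeff i +
      s ^ 2 * (lowPoly v.1 * lowPoly v.2).coeff i := by
    funext s
    simp only [← coeff_C_mul, ← coeff_add, mulCoeff]
    congr 1
    simp only [monicPoly, Prod.fst_add, Prod.snd_add, Prod.smul_fst, Prod.smul_snd,
      lowPoly_add_smul, C_pow]
    ring
  rw [h3] at h2
  refine h2.unique ?_
  have := (((hasDerivAt_id (0 : ℂ)).mul_const
    ((lowPoly v.1 * monicPoly p.2 + monicPoly p.1 * lowPoly v.2).coeff i)).const_add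
    ((monicPoly p.1 * monicPoly p.2).coeff i)).fun_add
    (((hasDerivAt_id (0 : ℂ)).pow 2).mul_const ((lowPoly v.1 * lowPoly v.2).coeff i))
  simpa using this

lemma fderiv_mulCoeff_injective {a b : ℕ} {p : (Fin a → ℂ) × (Fin b → ℂ)}
    (hp : IsCoprime (monicPoly p.1) (monicPoly p.2)) :
    Function.Injective (fderiv ℂ mulCoeff p) := by
  rw [injective_iff_map_eq_zero]
  intro v hv
  have hsum : lowPoly v.1 * monicPoly p.2 + lowPoly v.2 * monicPoly p.1 = 0 := by
    have hdeg : (lowPoly v.1 * monicPoly p.2 + lowPoly v.2 * monicPoly p.1).degree <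
        (a + b : ℕ) := by
      refine (degree_add_le _ _).trans_lt (max_lt ?_ ?_)
      · rw [degree_mul, degree_monicPoly, Nat.cast_add]
        exact WithBot.add_lt_add_right (by simp) (degree_lowPoly_lt _)
      · rw [degree_mul, degree_monicPoly, Nat.cast_add, add_comm (a : WithBot ℕ)]
        exact WithBot.add_lt_add_right (by simp) (degree_lowPoly_lt _)
    ext i
    by_cases hi : i < a + b
    · have := fderiv_mulCoeff p v ⟨i, hi⟩
      rw [hv, mul_comm (monicPoly p.1)] at this
      simpa using this.symm
    · exact coeff_eq_zero_of_degree_lt (hdeg.trans_le (by exact_mod_cast not_lt.1 hi))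
  refine Prod.ext (lowPoly_injective ?_) (lowPoly_injective ?_)
  · rw [Prod.fst_zero, lowPoly_zero]
    refine eq_zero_of_isCoprime_of_add_mul_eq_zero hp ?_ (W := lowPoly v.2)
      (by linear_combination hsum)
    rw [degree_monicPoly]; exact degree_lowPoly_lt _
  · rw [Prod.snd_zero, lowPoly_zero]
    refine eq_zero_of_isCoprime_of_add_mul_eq_zero hp.symm ?_ (W := lowPoly v.1)
      (by linear_combination hsum)
    rw [degree_monicPoly]; exact degree_lowPoly_lt _

/-- Hensel's lemma for holomorphic families of monic polynomials. -/
lemma exists_analytic_factorization {a b : ℕ} {p : (Fin a → ℂ) × (Fin b → ℂ)}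
    (hp : IsCoprime (monicPoly p.1) (monicPoly p.2)) {u : ℂ → Fin (a + b) → ℂ} {z₀ : ℂ}
    (hu : AnalyticAt ℂ u z₀) (h0 : monicPoly (u z₀) = monicPoly p.1 * monicPoly p.2) :
    ∃ (q : ℂ → Fin a → ℂ) (r : ℂ → Fin b → ℂ), AnalyticAt ℂ q z₀ ∧ AnalyticAt ℂ r z₀ ∧
      ∀ᶠ z in 𝓝 z₀, monicPoly (u z) = monicPoly (q z) * monicPoly (r z) := by
  have hF := analyticAt_mulCoeff p
  let e : ((Fin a → ℂ) × (Fin b → ℂ)) ≃L[ℂ] (Fin (a + b) → ℂ) :=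
    (LinearMap.linearEquivOfInjective (fderiv ℂ mulCoeff p).toLinearMap
      (fderiv_mulCoeff_injective hp) (by simp)).toContinuousLinearEquiv
  have he : HasFDerivAt mulCoeff (e : _ →L[ℂ] _) p :=
    hF.differentiableAt.hasFDerivAt.congr_fderiv (ContinuousLinearMap.ext fun _ => rfl)
  have hu0 : u z₀ = mulCoeff p := by
    funext i
    rw [← coeff_monicPoly (u z₀) i, h0]
    rfl
  have hcω : ContDiffAt ℂ ⊤ mulCoeff p := hF.contDiffAt
  have hinv := (hcω.to_localInverse he (by simp)).analyticAt
  rw [← hu0] at hinv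
  have hg := hinv.comp hu
  refine ⟨_, _, analyticAt_fst.comp hg, analyticAt_snd.comp hg, ?_⟩
  have hright := (hcω.hasStrictFDerivAt' he (by simp)).eventually_right_inverse
  rw [← hu0] at hright
  filter_upwards [hu.continuousAt.eventually hright] with z hz
  conv_lhs => rw [← hz, monicPoly_mulCoeff]
  rfl

/-- A set-valued function `R` all of whose values near `0` are, after the substitution
`z ↦ z ^ N`, among the values of finitely many analytic functions. -/
def PuiseuxCoveredBy (N : ℕ) (R : ℂ → Set ℂ) : Prop :=
  ∃ S : Set (ℂ → ℂ), S.Finite ∧ (∀ a ∈ S, AnalyticAt ℂ a 0) ∧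
    ∀ᶠ z in 𝓝[≠] (0 : ℂ), ∀ t ∈ R (z ^ N), ∃ a ∈ S, a z = t

/-- `PuiseuxCoveredBy N R` for some positive `N`. -/
def PuiseuxCovered (R : ℂ → Set ℂ) : Prop := ∃ N, 0 < N ∧ PuiseuxCoveredBy N R

lemma tendsto_pow_punctured {N : ℕ} (hN : 0 < N) :
    Tendsto (fun z : ℂ => z ^ N) (𝓝[≠] 0) (𝓝[≠] 0) := by
  refine tendsto_nhdsWithin_of_tendsto_nhds_of_eventually_within _ ?_ ?_
  · have : Tendsto (fun z : ℂ => z ^ N) (𝓝 0) (𝓝 (0 ^ N)) := (continuous_pow N).tendsto 0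
    rw [zero_pow hN.ne'] at this
    exact this.mono_left nhdsWithin_le_nhds
  · filter_upwards [self_mem_nhdsWithin] with z hz
    exact pow_ne_zero N hz

lemma AnalyticAt.comp_pow_zero {E : Type*} [NormedAddCommGroup E] [NormedSpace ℂ E]
    {f : ℂ → E} (hf : AnalyticAt ℂ f 0) {N : ℕ} (hN : 0 < N) :
    AnalyticAt ℂ (fun z => f (z ^ N)) 0 := by
  refine AnalyticAt.fun_comp (g := f) ?_ (analyticAt_id.fun_pow N)
  simpa [hN.ne'] using hf

lemma PuiseuxCoveredBy.mul_right {N : ℕ} {R : ℂ → Set ℂ} (h : PuiseuxCoveredBy N R) {M : ℕ}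
    (hM : 0 < M) : PuiseuxCoveredBy (N * M) R := by
  obtain ⟨S, hS, hSa, hR⟩ := h
  refine ⟨(fun a z => a (z ^ M)) '' S, hS.image _, ?_, ?_⟩
  · rintro _ ⟨a, ha, rfl⟩
    exact (hSa a ha).comp_pow_zero hM
  · filter_upwards [(tendsto_pow_punctured hM).eventually hR] with z hz t ht
    obtain ⟨a, ha, hat⟩ := hz t (by rwa [← pow_mul, mul_comm M])
    exact ⟨_, ⟨a, ha, rfl⟩, hat⟩

namespace PuiseuxCovered

variable {R R' : ℂ → Set ℂ}

lemma mono (h : PuiseuxCovered R') (hR : ∀ᶠ z in 𝓝[≠] (0 : ℂ), R z ⊆ R' z) :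
    PuiseuxCovered R := by
  obtain ⟨N, hN, S, hS, hSa, hR'⟩ := h
  refine ⟨N, hN, S, hS, hSa, ?_⟩
  filter_upwards [hR', (tendsto_pow_punctured hN).eventually hR] with z h1 h2 t ht
  exact h1 t (h2 ht)

lemma of_pow {q : ℕ} (hq : 0 < q) (h : PuiseuxCovered fun z => R (z ^ q)) :
    PuiseuxCovered R := by
  obtain ⟨N, hN, S, hS, hSa, hR⟩ := h
  refine ⟨N * q, Nat.mul_pos hN hq, S, hS, hSa, ?_⟩
  simpa only [pow_mul] using hR

lemma union (h : PuiseuxCovered R) (h' : PuiseuxCovered R') :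
    PuiseuxCovered fun z => R z ∪ R' z := by
  obtain ⟨N, hN, h⟩ := h
  obtain ⟨N', hN', h'⟩ := h'
  obtain ⟨S, hS, hSa, hR⟩ := h.mul_right hN'
  obtain ⟨S', hS', hSa', hR'⟩ := h'.mul_right hN
  rw [mul_comm N' N] at hR'
  refine ⟨N * N', Nat.mul_pos hN hN', S ∪ S', hS.union hS', ?_, ?_⟩
  · rintro a (ha | ha)
    exacts [hSa a ha, hSa' a ha]
  · filter_upwards [hR, hR'] with z hz hz'
    rintro t (ht | ht)
    · obtain ⟨a, ha, hat⟩ := hz t ht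
      exact ⟨a, Or.inl ha, hat⟩
    · obtain ⟨a, ha, hat⟩ := hz' t ht
      exact ⟨a, Or.inr ha, hat⟩

lemma affine_image {f g : ℂ → ℂ} (hf : AnalyticAt ℂ f 0) (hg : AnalyticAt ℂ g 0)
    (h : PuiseuxCovered R) : PuiseuxCovered fun z => (fun t => f z * t + g z) '' R z := by
  obtain ⟨N, hN, S, hS, hSa, hR⟩ := h
  refine ⟨N, hN, (fun a z => f (z ^ N) * a z + g (z ^ N)) '' S, hS.image _, ?_, ?_⟩
  · rintro _ ⟨a, ha, rfl⟩
    exact ((hf.comp_pow_zero hN).fun_mul (hSa a ha)).fun_add (hg.comp_pow_zero hN)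
  · filter_upwards [hR] with z hz
    rintro _ ⟨t, ht, rfl⟩
    obtain ⟨a, ha, rfl⟩ := hz t ht
    exact ⟨_, ⟨a, ha, rfl⟩, rfl⟩

end PuiseuxCovered

/-- The roots of the family of monic polynomials with lower coefficients `u`. -/
def rootFamily {d : ℕ} (u : ℂ → Fin d → ℂ) (z : ℂ) : Set ℂ := {t | (monicPoly (u z)).eval t = 0}

lemma mem_rootFamily {d : ℕ} {u : ℂ → Fin d → ℂ} {z t : ℂ} :
    t ∈ rootFamily u z ↔ (monicPoly (u z)).eval t = 0 := Iff.rfl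

lemma puiseuxCovered_of_ne_pow {d : ℕ} (hd : 0 < d)
    (ih : ∀ e < d, ∀ v : ℂ → Fin e → ℂ, AnalyticAt ℂ v 0 → PuiseuxCovered (rootFamily v))
    {u : ℂ → Fin d → ℂ} (hu : AnalyticAt ℂ u 0)
    (hne : ∀ w : ℂ, monicPoly (u 0) ≠ (X - C w) ^ d) : PuiseuxCovered (rootFamily u) := by
  obtain ⟨w, hw⟩ := Complex.exists_root (f := monicPoly (u 0)) (by
    rw [degree_monicPoly]; exact_mod_cast hd)
  obtain ⟨g, hg, hndvd⟩ := (monicPoly (u 0)).exists_eq_pow_rootMultiplicity_mul_and_not_dvd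
    (monicPoly_monic _).ne_zero w
  have hkpos := (rootMultiplicity_pos (monicPoly_monic (u 0)).ne_zero).2 hw
  generalize (monicPoly (u 0)).rootMultiplicity w = k at hg hkpos
  have hkm : ((X - C w) ^ k).Monic := (monic_X_sub_C w).pow k
  have hkd : ((X - C w) ^ k).natDegree = k := by simp
  have hgm : g.Monic := hkm.of_mul_monic_left (hg ▸ monicPoly_monic (u 0))
  have hdeg : d = k + g.natDegree := by
    rw [← natDegree_monicPoly (u 0), hg, hkm.natDegree_mul hgm, hkd]
  generalize hb : g.natDegree = b at hdeg
  subst hdeg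
  have hbpos : 0 < b := by
    refine Nat.pos_of_ne_zero fun h => hne w ?_
    subst h
    rw [hg, hgm.natDegree_eq_zero.1 hb, mul_one, add_zero]
  have hcop : IsCoprime ((X - C w) ^ k) g :=
    ((irreducible_X_sub_C w).coprime_iff_not_dvd.2 hndvd).pow_left
  rw [← monicPoly_coeff hkm hkd, ← monicPoly_coeff hgm hb] at hcop hg
  obtain ⟨q, r, hq, hr, hqr⟩ := exists_analytic_factorization (p := (_, _)) hcop hu hg
  refine ((ih k (by omega) q hq).union (ih b (by omega) r hr)).mono ?_
  filter_upwards [hqr.filter_mono nhdsWithin_le_nhds] with z hz t ht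
  rw [mem_rootFamily, hz, eval_mul, mul_eq_zero] at ht
  exact ht

/-- The change of variables along the first edge of the Newton polygon. -/
lemma exists_newton_substitution {d : ℕ} {u : ℂ → Fin d → ℂ} (hu : AnalyticAt ℂ u 0)
    (hne : ∃ i, ¬ ∀ᶠ z in 𝓝 0, u z i = 0) :
    ∃ (p q : ℕ) (v : ℂ → Fin d → ℂ), 0 < q ∧ AnalyticAt ℂ v 0 ∧
      (∀ᶠ z in 𝓝 0, ∀ i : Fin d, u (z ^ q) i = z ^ (p * (d - i)) * v z i) ∧
      (∃ i, v 0 i ≠ 0) ∧ ∀ i, (∀ᶠ z in 𝓝 0, u z i = 0) → v 0 i = 0 := by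
  classical
  have hui := analyticAt_pi_iff.1 hu
  let ord : Fin d → ℕ := fun i => analyticOrderNatAt (fun z => u z i) 0
  obtain ⟨i₀, hi₀, hmin⟩ := Finset.exists_min_image
    (Finset.univ.filter fun i => ¬ ∀ᶠ z in 𝓝 0, u z i = 0)
    (fun i => (ord i : ℚ) / ((d - i : ℕ) : ℚ)) (by simpa [Finset.Nonempty] using hne)
  have hq : 0 < d - (i₀ : ℕ) := Nat.sub_pos_of_lt i₀.2
  have hv : ∀ i : Fin d, ∃ b : ℂ → ℂ, AnalyticAt ℂ b 0 ∧
      (∀ᶠ z in 𝓝 0, u (z ^ (d - (i₀ : ℕ))) i = z ^ (ord i₀ * (d - i)) * b z) ∧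
      (i = i₀ → b 0 ≠ 0) ∧ ((∀ᶠ z in 𝓝 0, u z i = 0) → b 0 = 0) := by
    intro i
    have htend : Tendsto (fun z : ℂ => z ^ (d - (i₀ : ℕ))) (𝓝 0) (𝓝 0) := by
      simpa [hq.ne'] using (continuous_pow (M := ℂ) (d - (i₀ : ℕ))).tendsto 0
    by_cases hi : ∀ᶠ z in 𝓝 0, u z i = 0
    · refine ⟨0, analyticAt_const, ?_, ?_, fun _ => rfl⟩
      · filter_upwards [htend.eventually hi] with z hz
        simp [hz]
      · rintro rfl
        exact absurd hi (Finset.mem_filter.1 hi₀).2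
    · have hle : ord i₀ * (d - i) ≤ (d - i₀) * ord i := by
        have := hmin i (Finset.mem_filter.2 ⟨Finset.mem_univ i, hi⟩)
        have hq' : 0 < d - (i : ℕ) := Nat.sub_pos_of_lt i.2
        rw [div_le_div_iff₀ (by exact_mod_cast hq) (by exact_mod_cast hq')] at this
        rw [mul_comm (d - (i₀ : ℕ))]
        exact_mod_cast this
      obtain ⟨g, hg, hg0, hug⟩ := ((hui i).analyticOrderAt_eq_natCast (n := ord i)).1
        (Nat.cast_analyticOrderNatAt (by rwa [Ne, analyticOrderAt_eq_top])).symm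
      refine ⟨fun z => z ^ ((d - i₀) * ord i - ord i₀ * (d - i)) * g (z ^ (d - (i₀ : ℕ))),
        (analyticAt_id.fun_pow _).fun_mul (hg.comp_pow_zero hq), ?_, ?_, fun h => absurd h hi⟩
      · filter_upwards [htend.eventually hug] with z hz
        rw [hz, sub_zero, smul_eq_mul, ← pow_mul, ← mul_assoc, ← pow_add, Nat.add_sub_cancel' hle]
      · rintro rfl
        simpa [mul_comm (ord i), hq.ne'] using hg0
  choose v hva hv1 hv2 hv3 using hv
  exact ⟨ord i₀, d - i₀, fun z i => v i z, hq, analyticAt_pi_iff.2 hva, eventually_all.2 hv1,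
    ⟨i₀, hv2 i₀ rfl⟩, hv3⟩

lemma monicPoly_ne_pow {d : ℕ} {u : Fin (d + 1) → ℂ} (hlast : u (Fin.last d) = 0)
    (hne : ∃ i, u i ≠ 0) (w : ℂ) : monicPoly u ≠ (X - C w) ^ (d + 1) := by
  intro h
  obtain ⟨i, hi⟩ := hne
  have hw : w = 0 := by
    have h1 := coeff_monicPoly u (Fin.last d)
    rw [h, hlast, sub_eq_add_neg, ← C_neg, coeff_X_add_C_pow] at h1
    simpa [Nat.cast_add_one_ne_zero] using h1
  apply hi
  rw [← coeff_monicPoly u i, h, hw]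
  simp [coeff_X_pow, i.2.ne]

lemma puiseuxCovered_of_last_eq_zero {d : ℕ} {u : ℂ → Fin (d + 1) → ℂ} (hu : AnalyticAt ℂ u 0)
    (hlast : ∀ᶠ z in 𝓝 0, u z (Fin.last d) = 0)
    (h : ∀ v : ℂ → Fin (d + 1) → ℂ, AnalyticAt ℂ v 0 →
      (∀ w : ℂ, monicPoly (v 0) ≠ (X - C w) ^ (d + 1)) → PuiseuxCovered (rootFamily v)) :
    PuiseuxCovered (rootFamily u) := by
  by_cases hne : ∃ i, ¬ ∀ᶠ z in 𝓝 0, u z i = 0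
  · obtain ⟨p, q, v, hq, hv, huv, hv0, hvz⟩ := exists_newton_substitution hu hne
    have hcov := h v hv (monicPoly_ne_pow (hvz _ hlast) hv0)
    refine PuiseuxCovered.of_pow hq ((hcov.affine_image (f := fun z => z ^ p)
      (analyticAt_id.fun_pow p) (analyticAt_const (v := 0))).mono ?_)
    filter_upwards [huv.filter_mono nhdsWithin_le_nhds, self_mem_nhdsWithin] with z hz hz0 t ht
    have hzp : z ^ p ≠ 0 := pow_ne_zero p hz0
    have hts : t = z ^ p * (t / z ^ p) := by field_simp
    generalize t / z ^ p = s at hts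
    subst hts
    refine ⟨s, ?_, by simp⟩
    rw [mem_rootFamily, eval_monicPoly] at ht ⊢
    refine (mul_eq_zero.1 ?_).resolve_left (pow_ne_zero (d + 1) hzp)
    rw [← ht, mul_add, Finset.mul_sum, mul_pow]
    congr 1
    refine Finset.sum_congr rfl fun i _ => ?_
    rw [hz i, pow_mul, mul_pow]
    nth_rewrite 1 [← Nat.sub_add_cancel i.2.le, pow_add]
    ring
  · push Not at hne
    refine ⟨1, one_pos, {fun _ => 0}, finite_singleton _, ?_, ?_⟩
    · rintro _ rfl
      exact analyticAt_const
    refine eventually_nhdsWithin_of_eventually_nhds ?_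
    filter_upwards [eventually_all.2 hne] with z hz t ht
    rw [mem_rootFamily, eval_monicPoly, pow_one] at ht
    simp only [hz, zero_mul, Finset.sum_const_zero, add_zero] at ht
    exact ⟨_, rfl, (eq_zero_of_pow_eq_zero ht).symm⟩

lemma coeff_comp_X_sub_C_last {d : ℕ} (u : Fin (d + 1) → ℂ) (h : ℂ) :
    ((monicPoly u).comp (X - C h)).coeff d = u (Fin.last d) - (d + 1) * h := by
  have hdeg : (hasseDeriv d (monicPoly u)).natDegree ≤ 1 := by
    refine (natDegree_hasseDeriv_le _ _).trans ?_
    rw [natDegree_monicPoly]; omega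
  have h0 : (hasseDeriv d (monicPoly u)).coeff 0 = u (Fin.last d) := by
    rw [hasseDeriv_coeff, ← coeff_monicPoly u (Fin.last d)]; simp
  have h1 : (hasseDeriv d (monicPoly u)).coeff 1 = d + 1 := by
    have := (monicPoly_monic u).coeff_natDegree
    rw [natDegree_monicPoly] at this
    rw [hasseDeriv_coeff, add_comm 1 d, this]; simp
  have := taylor_coeff (-h) (monicPoly u) d
  rw [eq_X_add_C_of_natDegree_le_one hdeg, h0, h1, taylor_apply, C_neg, ← sub_eq_add_neg] at this
  rw [this]
  simp
  ring

/-- Puiseux's theorem: after a substitution `z ↦ z ^ N`, the roots of a monic polynomial with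
analytic coefficients are values of finitely many analytic functions. -/
theorem puiseuxCovered_rootFamily (d : ℕ) (u : ℂ → Fin d → ℂ) (hu : AnalyticAt ℂ u 0) :
    PuiseuxCovered (rootFamily u) := by
  induction d using Nat.strong_induction_on with
  | _ d ih =>
  obtain _ | d := d
  · refine ⟨1, one_pos, ∅, finite_empty, by simp, .of_forall fun z t ht => ?_⟩
    simp [rootFamily, eval_monicPoly] at ht
  let h : ℂ → ℂ := fun z => u z (Fin.last d) / (d + 1)
  have hh : AnalyticAt ℂ h 0 := (analyticAt_pi_iff.1 hu _).fun_div analyticAt_const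
    (Nat.cast_add_one_ne_zero d)
  let P : ℂ → ℂ[X] := fun z => (monicPoly (u z)).comp (X - C (h z))
  have hPm (z) : (P z).Monic := (monicPoly_monic _).comp_X_sub_C _
  have hPd (z) : (P z).natDegree = d + 1 := by simp [P, natDegree_comp, natDegree_monicPoly]
  have hPa : AnalyticCoeffAt P 0 := by
    have hX : AnalyticCoeffAt (fun z => X - C (h z)) 0 := by
      simpa only [sub_eq_add_neg, ← C_neg] using
        (analyticCoeffAt_const X).add hh.fun_neg.analyticCoeffAt_C
    have : P = fun z => (X - C (h z)) ^ (d + 1) +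
        ∑ i, C (u z i) * (X - C (h z)) ^ (i : ℕ) := by
      funext z
      simp [P, monicPoly, lowPoly]
    rw [this]
    exact (hX.pow _).add <| AnalyticCoeffAt.sum _ fun i _ =>
      (analyticAt_pi_iff.1 hu i).analyticCoeffAt_C.mul (hX.pow _)
  have hcov := puiseuxCovered_of_last_eq_zero (hPa.analyticAt_coeff (d + 1))
    (.of_forall fun z => by
      have : ((d : ℂ) + 1) ≠ 0 := Nat.cast_add_one_ne_zero d
      rw [Fin.val_last, coeff_comp_X_sub_C_last]
      simp only [h]
      field_simp
      simp)
    fun v hv => puiseuxCovered_of_ne_pow d.succ_pos ih hv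
  refine (hcov.affine_image (f := fun _ => 1) analyticAt_const hh.neg).mono
    (.of_forall fun z t ht => ⟨t + h z, ?_, by simp⟩)
  rw [mem_rootFamily, monicPoly_coeff (hPm z) (hPd z)]
  simpa [P, eval_comp, mem_rootFamily] using ht

lemma eval_aeval_eq {m n : ℕ} (σ : Fin n → MvPolynomial (Fin m) ℂ) (x : Fin m → ℂ)
    (p : MvPolynomial (Fin n) ℂ) :
    MvPolynomial.eval x (MvPolynomial.aeval σ p) =
      MvPolynomial.eval (fun k => MvPolynomial.eval x (σ k)) p := by
  induction p using MvPolynomial.induction_on <;> simp_all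

/-- Each coordinate `x j` is a root of a monic polynomial whose coefficients are polynomials in
the values at `x` of the generators of the algebra of invariants. -/
lemma exists_coordinate_equation {m n : ℕ} {G : Type} [Group G] [Fintype G]
    (ρ : G →* ((Fin m → ℂ) ≃ₗ[ℂ] (Fin m → ℂ))) (σ : Fin n → MvPolynomial (Fin m) ℂ)
    (hgen : ∀ f : MvPolynomial (Fin m) ℂ,
      (∀ g x, MvPolynomial.eval (ρ g x) f = MvPolynomial.eval x f) →
      ∃ p : MvPolynomial (Fin n) ℂ, MvPolynomial.aeval σ p = f) (j : Fin m) :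
    ∃ p : Fin (Fintype.card G) → MvPolynomial (Fin n) ℂ, ∀ x : Fin m → ℂ,
      (monicPoly fun i => MvPolynomial.eval (fun k => MvPolynomial.eval x (σ k)) (p i)).eval
        (x j) = 0 := by
  let L : G → MvPolynomial (Fin m) ℂ := fun g =>
    ∑ k, MvPolynomial.X k * MvPolynomial.C (ρ g (fun i => if k = i then 1 else 0) j)
  have hL (g x) : MvPolynomial.eval x (L g) = ρ g x j := by
    conv_rhs => rw [← LinearEquiv.coe_coe, LinearMap.pi_apply_eq_sum_univ]
    simp [L, Finset.sum_apply]
  let Q : (MvPolynomial (Fin m) ℂ)[X] := ∏ g, (X - C (L g))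
  have hQ (x) : Q.map (MvPolynomial.eval x) = ∏ g, (X - C (ρ g x j)) := by
    simp [Q, Polynomial.map_prod, hL]
  have hinv (h x) : Q.map (MvPolynomial.eval (ρ h x)) = Q.map (MvPolynomial.eval x) := by
    rw [hQ, hQ]
    refine Fintype.prod_equiv (Equiv.mulRight h) _ _ fun g => ?_
    simp
  have hcoeff (i : ℕ) : ∃ p, MvPolynomial.aeval σ p = Q.coeff i :=
    hgen _ fun h x => by rw [← coeff_map, hinv, coeff_map]
  choose p hp using hcoeff
  refine ⟨fun i => p i, fun x => ?_⟩
  have hm : (∏ g, (X - C (ρ g x j))).Monic := monic_prod_X_sub_C _ _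
  have hd : (∏ g, (X - C (ρ g x j))).natDegree = Fintype.card G := by
    simp [natDegree_prod_of_monic _ _ fun g _ => monic_X_sub_C (ρ g x j)]
  have : (fun i : Fin (Fintype.card G) =>
      MvPolynomial.eval (fun k => MvPolynomial.eval x (σ k)) (p i)) =
      fun i : Fin (Fintype.card G) => (∏ g, (X - C (ρ g x j))).coeff i := by
    funext i
    rw [← eval_aeval_eq, hp, ← hQ, coeff_map]
  rw [this, monicPoly_coeff hm hd, eval_prod]
  exact Finset.prod_eq_zero (Finset.mem_univ 1) (by simp)

/-- Finitely many Puiseux coverings can be realised with a common exponent. -/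
lemma exists_common_puiseuxCoveredBy {m : ℕ} {R : Fin m → ℂ → Set ℂ}
    (h : ∀ j, PuiseuxCovered (R j)) : ∃ N, 0 < N ∧ ∀ j, PuiseuxCoveredBy N (R j) := by
  choose N hN hR using h
  refine ⟨∏ j, N j, Finset.prod_pos fun j _ => hN j, fun j => ?_⟩
  rw [← Finset.mul_prod_erase _ _ (Finset.mem_univ j)]
  exact (hR j).mul_right (Finset.prod_pos fun j _ => hN j)

/-- A curve in `σ(ℂ^m)` analytic at `0` has, after a substitution `z ↦ z ^ N`, a lift analytic
at `0`. -/
lemma exists_analytic_lift {m n : ℕ} {G : Type} [Group G] [Fintype G]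
    (ρ : G →* ((Fin m → ℂ) ≃ₗ[ℂ] (Fin m → ℂ))) (σ : Fin n → MvPolynomial (Fin m) ℂ)
    (hgen : ∀ f : MvPolynomial (Fin m) ℂ,
      (∀ g x, MvPolynomial.eval (ρ g x) f = MvPolynomial.eval x f) →
      ∃ p : MvPolynomial (Fin n) ℂ, MvPolynomial.aeval σ p = f)
    {c : ℂ → Fin n → ℂ} (hc : AnalyticAt ℂ c 0)
    (hcσ : ∀ᶠ z in 𝓝 0, ∃ x : Fin m → ℂ, (fun k => MvPolynomial.eval x (σ k)) = c z) :
    ∃ N, 0 < N ∧ ∃ a : ℂ → Fin m → ℂ, AnalyticAt ℂ a 0 ∧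
      ∀ᶠ z in 𝓝 0, (fun k => MvPolynomial.eval (a z) (σ k)) = c (z ^ N) := by
  choose p hp using exists_coordinate_equation ρ σ hgen
  obtain ⟨N, hN, hcov⟩ := exists_common_puiseuxCoveredBy fun j =>
    puiseuxCovered_rootFamily _ (fun z i => MvPolynomial.eval (c z) (p j i))
      (analyticAt_pi_iff.2 fun i => AnalyticAt.aeval_mvPolynomial
        (analyticAt_pi_iff.1 hc) (p j i))
  choose S hS hSa hR using hcov
  have hex : ∀ᶠ z in 𝓝[≠] (0 : ℂ), ∃ a ∈ Set.pi univ S,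
      (fun k => MvPolynomial.eval (fun j => a j z) (σ k)) = c (z ^ N) := by
    filter_upwards [eventually_all.2 hR, (tendsto_pow_punctured hN).eventually
      (eventually_nhdsWithin_of_eventually_nhds hcσ)] with z hz ⟨x, hx⟩
    have hx' (j) : ∃ a ∈ S j, a z = x j := by
      refine hz j _ ?_
      rw [mem_rootFamily, ← hx]
      exact hp j x
    choose a haS haz using hx'
    exact ⟨a, fun j _ => haS j, by simpa only [haz] using hx⟩
  obtain ⟨a, haS, ha⟩ := (frequently_exists_finite (Set.Finite.pi hS)).1 hex.frequently
  have haa (j) : AnalyticAt ℂ (a j) 0 := hSa j _ (haS j trivial)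
  refine ⟨N, hN, fun z j => a j z, analyticAt_pi_iff.2 haa, ?_⟩
  refine (AnalyticAt.frequently_eq_iff_eventually_eq ?_ (hc.comp_pow_zero hN)).1 ha
  exact analyticAt_pi_iff.2 fun k => AnalyticAt.aeval_mvPolynomial haa (σ k)

end Puiseux

/-- Puiseux-type theorem (finite group, holomorphic case): after the substitution
`z ↦ z₀ + (z - z₀)^N` a holomorphic curve in `σ(ℂ^m)` admits a holomorphic lift near `z₀`. -/
theorem stmt4
    {m n : ℕ} {G : Type} [Group G] [Fintype G]
    (ρ : G →* ((Fin m → ℂ) ≃ₗ[ℂ] (Fin m → ℂ)))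
    (σ : Fin n → MvPolynomial (Fin m) ℂ) (deg : Fin n → ℕ)
    (hdeg : ∀ k, 1 ≤ deg k)
    (hhom : ∀ k, (σ k).IsHomogeneous (deg k))
    (hinv : ∀ k g x, MvPolynomial.eval (ρ g x) (σ k) = MvPolynomial.eval x (σ k))
    (hgen : ∀ f : MvPolynomial (Fin m) ℂ,
      (∀ g x, MvPolynomial.eval (ρ g x) f = MvPolynomial.eval x f) →
      ∃ p : MvPolynomial (Fin n) ℂ, MvPolynomial.aeval σ p = f)
    (σm : (Fin m → ℂ) → (Fin n → ℂ))
    (hσm : ∀ x k, σm x k = MvPolynomial.eval x (σ k))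
    (U : Set ℂ) (hU : IsOpen U) (hUc : IsConnected U)
    (z₀ : ℂ) (hz₀ : z₀ ∈ U)
    (c : ℂ → Fin n → ℂ) (hc : DifferentiableOn ℂ c U)
    (hcσ : ∀ z ∈ U, ∃ x : Fin m → ℂ, σm x = c z) :
    ∃ (N : ℕ) (δ : ℝ) (cb : ℂ → Fin m → ℂ), 0 < N ∧ 0 < δ ∧
      DifferentiableOn ℂ cb (Metric.ball z₀ δ) ∧
      ∀ z ∈ Metric.ball z₀ δ,
        z₀ + (z - z₀) ^ N ∈ U ∧ σm (cb z) = c (z₀ + (z - z₀) ^ N) := by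
  obtain rfl : σm = fun x k => MvPolynomial.eval x (σ k) := funext fun x => funext (hσm x)
  have hshift : Tendsto (fun w : ℂ => z₀ + w) (nhds 0) (nhds z₀) := by
    simpa using (continuous_const_add z₀).tendsto 0
  have hca : AnalyticAt ℂ (fun w => c (z₀ + w)) 0 := by
    refine AnalyticAt.fun_comp (g := c) ?_ (analyticAt_const.fun_add analyticAt_id)
    simpa using hc.analyticAt (hU.mem_nhds hz₀)
  obtain ⟨N, hN, a, ha, hlift⟩ := exists_analytic_lift ρ σ hgen hca
    ((hshift.eventually (hU.mem_nhds hz₀)).mono fun w hw => hcσ _ hw)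
  have hpow : Tendsto (fun w : ℂ => z₀ + w ^ N) (nhds 0) (nhds z₀) := by
    refine hshift.comp ?_
    simpa [hN.ne'] using (continuous_pow (M := ℂ) N).tendsto 0
  obtain ⟨δ, hδ, hball⟩ := Metric.eventually_nhds_iff_ball.1
    (ha.eventually_analyticAt.and (hlift.and (hpow.eventually (hU.mem_nhds hz₀))))
  have hsub {z : ℂ} (hz : z ∈ Metric.ball z₀ δ) : z - z₀ ∈ Metric.ball 0 δ := by
    rwa [mem_ball_zero_iff, ← dist_eq_norm]
  refine ⟨N, δ, fun z => a (z - z₀), hN, hδ, fun z hz => ?_, fun z hz => ?_⟩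
  · exact ((hball _ (hsub hz)).1.differentiableAt.comp z
      (differentiableAt_id.sub_const z₀)).differentiableWithinAt
  · exact ⟨(hball _ (hsub hz)).2.2, (hball _ (hsub hz)).2.1⟩
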